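/- arXiv:2004.01416 — 12 statements merged into one kernel-verified Lean document; each statement's English description precedes it below -/
import Mathlib

section
/- For all θ₁, θ₂ ∈ [0, 2π) one has −3√3/2 ≤ f(θ₁, θ₂) ≤ 3√3/2, i.e. |sin(θ₁) + sin(θ₂ − θ₁) − sin(θ₂)| ≤ 3√3/2. -/
open Real

lemma sin_add_sin_sub_sin_add_le (a b : ℝ) :
    sin a + sin b - sin (a + b) ≤ 3 * √3 / 2 := by
  have hr : √3 * √3 = 3 := mul_self_sqrt (by norm_num)
  have hpos : 0 < √3 := by positivity
  rw [sin_add]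
  refine le_of_mul_le_mul_left ?_ hpos
  linear_combination (1 / 2) * sq_nonneg (sin a + √3 * cos b) +
    (1 / 2) * sq_nonneg (sin b + √3 * cos a) + sq_nonneg (sin a - √3 / 2) +
    sq_nonneg (sin b - √3 / 2) + (3 / 2) * sin_sq_add_cos_sq a + (3 / 2) * sin_sq_add_cos_sq b +
    ((cos a ^ 2 + cos b ^ 2) / 2 - 1) * hr

/-- For all `θ₁, θ₂ ∈ [0, 2π)` one has `|sin θ₁ + sin (θ₂ - θ₁) - sin θ₂| ≤ 3√3/2`. -/
theorem stmt_0 (θ₁ θ₂ : ℝ) (h₁ : θ₁ ∈ Set.Ico 0 (2 * π)) (h₂ : θ₂ ∈ Set.Ico 0 (2 * π)) :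
    |Real.sin θ₁ + Real.sin (θ₂ - θ₁) - Real.sin θ₂| ≤ 3 * Real.sqrt 3 / 2 := by
  have h := sin_add_sin_sub_sin_add_le θ₁ (θ₂ - θ₁)
  have h' := sin_add_sin_sub_sin_add_le (-θ₁) (-(θ₂ - θ₁))
  rw [← neg_add] at h'
  simp only [sin_neg, add_sub_cancel] at h h'
  exact abs_le.mpr ⟨by linarith, h⟩
end

section
/- For all θ₁, θ₂ ∈ [0, 2π), one has |f(θ₁, θ₂)| = 3√3/2 if and only if g(θ₁, θ₂) = −3/2. -/
open Real

/-- The equality case of `(1 - c²) (k - c)² ≤ 27 / 16` for `c, k ∈ [-1, 1]`. -/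
lemma two_mul_add_two_mul_sq_of_eq {c k : ℝ} (hc : c ^ 2 ≤ 1) (hk₁ : -1 ≤ k) (hk₂ : k ≤ 1)
    (h : (1 - c ^ 2) * (k - c) ^ 2 = 27 / 16) : 2 * c * k + 2 * c ^ 2 = -(1 / 2) := by
  have hr := abs_nonneg c
  have hle : (k - c) ^ 2 ≤ (1 + |c|) ^ 2 := by
    have habs : |k - c| ≤ 1 + |c| :=
      (abs_sub k c).trans (by linarith [abs_le.2 ⟨hk₁, hk₂⟩])
    exact sq_le_sq' (by linarith [neg_abs_le (k - c)]) ((le_abs_self _).trans habs)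
  have hmul := mul_le_mul_of_nonneg_left hle (sub_nonneg.2 hc)
  rw [h, ← sq_abs c] at hmul
  have hsq : (2 * |c| - 1) ^ 2 = 0 := by
    nlinarith [sq_nonneg (2 * |c| - 1), mul_nonneg (sq_nonneg (2 * |c| - 1)) hr,
      mul_nonneg (sq_nonneg (2 * |c| - 1)) (sq_nonneg |c|)]
  have hhalf : |c| = 1 / 2 := by linarith [pow_eq_zero_iff two_ne_zero |>.1 hsq]
  rcases eq_or_eq_neg_of_abs_eq hhalf with rfl | rfl
  · have : (k - 2) * (k + 1) = 0 := by linarith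
    rcases mul_eq_zero.1 this with h' | h' <;> linarith
  · have : (k + 2) * (k - 1) = 0 := by linarith
    rcases mul_eq_zero.1 this with h' | h' <;> linarith

lemma abs_eq_three_mul_sqrt_three_div_two_iff (x : ℝ) :
    |x| = 3 * √3 / 2 ↔ x ^ 2 = 27 / 4 := by
  have h3 : (3 * √3 / 2) ^ 2 = 27 / 4 := by
    rw [div_pow, mul_pow, sq_sqrt (by norm_num)]
    norm_num
  rw [← h3, sq_eq_sq_iff_abs_eq_abs, abs_of_nonneg (by positivity : 0 ≤ 3 * √3 / 2)]

/-- For all `θ₁, θ₂ ∈ [0, 2π)`, `|f(θ₁,θ₂)| = 3√3/2` if and only if `g(θ₁,θ₂) = -3/2`,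
where `f(θ₁,θ₂) = sin θ₁ + sin (θ₂ - θ₁) - sin θ₂` and
`g(θ₁,θ₂) = cos θ₁ + cos (θ₂ - θ₁) + cos θ₂`. -/
theorem stmt_1 (θ₁ θ₂ : ℝ) (h₁ : θ₁ ∈ Set.Ico 0 (2 * π)) (h₂ : θ₂ ∈ Set.Ico 0 (2 * π)) :
    |Real.sin θ₁ + Real.sin (θ₂ - θ₁) - Real.sin θ₂| = 3 * Real.sqrt 3 / 2 ↔
      Real.cos θ₁ + Real.cos (θ₂ - θ₁) + Real.cos θ₂ = -(3 / 2) := by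
  rw [abs_eq_three_mul_sqrt_three_div_two_iff]
  constructor
  · obtain ⟨s, rfl⟩ : ∃ s, θ₂ = 2 * s := ⟨θ₂ / 2, by ring⟩
    obtain ⟨d, rfl⟩ : ∃ d, θ₁ = s + d := ⟨θ₁ - s, by ring⟩
    rw [show 2 * s - (s + d) = s - d by ring, sin_add, sin_sub, cos_add, cos_sub, sin_two_mul,
      cos_two_mul]
    intro h
    have key : (1 - cos s ^ 2) * (cos d - cos s) ^ 2 = 27 / 16 := by
      rw [← sin_sq]
      linarith
    linarith [two_mul_add_two_mul_sq_of_eq (cos_sq_le_one s) (neg_one_le_cos d) (cos_le_one d) key]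
  · obtain ⟨b, rfl⟩ : ∃ b, θ₂ = θ₁ + b := ⟨θ₂ - θ₁, by ring⟩
    rw [add_sub_cancel_left, cos_add, sin_add]
    intro h
    have ha := sin_sq_add_cos_sq θ₁
    have hb := sin_sq_add_cos_sq b
    have hsum : (cos θ₁ + cos b + 1) ^ 2 + (sin θ₁ - sin b) ^ 2 = 0 := by linarith
    have hcos : cos θ₁ + cos b + 1 = 0 := by
      nlinarith [sq_nonneg (cos θ₁ + cos b + 1), sq_nonneg (sin θ₁ - sin b)]
    have hsin : sin b = sin θ₁ := by
      nlinarith [sq_nonneg (cos θ₁ + cos b + 1), sq_nonneg (sin θ₁ - sin b)]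
    have hcb : cos b = -1 - cos θ₁ := by linarith
    rw [hsin, hcb] at hb
    have hca : cos θ₁ = -(1 / 2) := by linarith
    rw [hca] at ha
    rw [hsin, hcb, hca]
    linarith
end

section
/- For every θ₁, θ₂ ∈ [0, 2π) one has f(θ₁, θ₁) = f(θ₁, 0) = f(0, θ₂) = 0. Moreover, for every θ₂ ∈ (0, 2π): f(θ₁, θ₂) > 0 for all θ₁ ∈ (0, θ₂), and f(θ₁, θ₂) < 0 for all θ₁ ∈ (θ₂, 2π). -/
open Real

/-- `f(θ₁,θ₂) = sin θ₁ + sin (θ₂ - θ₁) - sin θ₂`. -/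
noncomputable def f (θ₁ θ₂ : ℝ) : ℝ := Real.sin θ₁ + Real.sin (θ₂ - θ₁) - Real.sin θ₂

/-- `f` factors as `4 sin(θ₁/2) sin((θ₂ - θ₁)/2) sin(θ₂/2)`. -/
theorem f_eq_four_mul_sin_mul_sin_mul_sin (θ₁ θ₂ : ℝ) :
    f θ₁ θ₂ = 4 * Real.sin (θ₁ / 2) * Real.sin ((θ₂ - θ₁) / 2) * Real.sin (θ₂ / 2) := by
  obtain ⟨x, rfl⟩ : ∃ x, θ₁ = 2 * x := ⟨θ₁ / 2, by ring⟩
  obtain ⟨y, rfl⟩ : ∃ y, θ₂ = 2 * x + 2 * y := ⟨(θ₂ - 2 * x) / 2, by ring⟩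
  have hx : 2 * x / 2 = x := by ring
  have hy : (2 * x + 2 * y - 2 * x) / 2 = y := by ring
  have hxy : (2 * x + 2 * y) / 2 = x + y := by ring
  rw [f, hx, hy, hxy, add_sub_cancel_left, Real.sin_add, Real.sin_add]
  simp only [Real.sin_two_mul, Real.cos_two_mul, Real.cos_sq']
  ring

/-- For every `θ₁, θ₂ ∈ [0, 2π)`: `f(θ₁,θ₁) = f(θ₁,0) = f(0,θ₂) = 0`; moreover for every
`θ₂ ∈ (0, 2π)`, `f(·,θ₂) > 0` on `(0, θ₂)` and `f(·,θ₂) < 0` on `(θ₂, 2π)`. -/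
theorem stmt_2 :
    (∀ θ₁ ∈ Set.Ico (0 : ℝ) (2 * π), ∀ θ₂ ∈ Set.Ico (0 : ℝ) (2 * π),
      f θ₁ θ₁ = 0 ∧ f θ₁ 0 = 0 ∧ f 0 θ₂ = 0) ∧
    (∀ θ₂ ∈ Set.Ioo (0 : ℝ) (2 * π),
      (∀ θ₁ ∈ Set.Ioo (0 : ℝ) θ₂, 0 < f θ₁ θ₂) ∧
      (∀ θ₁ ∈ Set.Ioo θ₂ (2 * π), f θ₁ θ₂ < 0)) := by
  refine ⟨fun θ₁ _ θ₂ _ => ⟨by simp [f], by simp [f], by simp [f]⟩, ?_⟩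
  rintro θ₂ ⟨h0, h2⟩
  have hs : 0 < Real.sin (θ₂ / 2) :=
    Real.sin_pos_of_pos_of_lt_pi (by linarith) (by linarith)
  refine ⟨?_, ?_⟩
  · rintro θ₁ ⟨h3, h4⟩
    have ha : 0 < Real.sin (θ₁ / 2) :=
      Real.sin_pos_of_pos_of_lt_pi (by linarith) (by linarith)
    have hb : 0 < Real.sin ((θ₂ - θ₁) / 2) :=
      Real.sin_pos_of_pos_of_lt_pi (by linarith) (by linarith)
    rw [f_eq_four_mul_sin_mul_sin_mul_sin]
    positivity
  · rintro θ₁ ⟨h3, h4⟩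
    have ha : 0 < Real.sin (θ₁ / 2) :=
      Real.sin_pos_of_pos_of_lt_pi (by linarith) (by linarith)
    have hb : Real.sin ((θ₂ - θ₁) / 2) < 0 :=
      Real.sin_neg_of_neg_of_neg_pi_lt (by linarith) (by linarith)
    rw [f_eq_four_mul_sin_mul_sin_mul_sin]
    exact mul_neg_of_neg_of_pos (mul_neg_of_pos_of_neg (by positivity) hb) hs
end

section
/- On the square [0, 2π) × [0, 2π), the function f attains its minimum value −3√3/2 exactly at the point (θ₁, θ₂) = (4π/3, 2π/3) and its maximum value 3√3/2 exactly at the point (θ₁, θ₂) = (2π/3, 4π/3); that is, f(4π/3, 2π/3) = −3√3/2, f(2π/3, 4π/3) = 3√3/2, and any (θ₁, θ₂) ∈ [0, 2π) × [0, 2π) with f(θ₁, θ₂) = −3√3/2 (resp. = 3√3/2) equals (4π/3, 2π/3) (resp. (2π/3, 4π/3)). -/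
open Real

theorem sin_two_pi_div_three : Real.sin (2 * π / 3) = Real.sqrt 3 / 2 := by
  rw [show 2 * π / 3 = π - π / 3 by ring, Real.sin_pi_sub, Real.sin_pi_div_three]

theorem cos_two_pi_div_three : Real.cos (2 * π / 3) = -(1 / 2) := by
  rw [show 2 * π / 3 = π - π / 3 by ring, Real.cos_pi_sub, Real.cos_pi_div_three]

theorem sin_four_pi_div_three : Real.sin (4 * π / 3) = -(Real.sqrt 3 / 2) := by
  rw [show 4 * π / 3 = π / 3 + π by ring, Real.sin_add_pi, Real.sin_pi_div_three]

theorem cos_four_pi_div_three : Real.cos (4 * π / 3) = -(1 / 2) := by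
  rw [show 4 * π / 3 = π / 3 + π by ring, Real.cos_add_pi, Real.cos_pi_div_three]

theorem eq_of_cos_eq_of_sin_eq {x y : ℝ} (hx : x ∈ Set.Ico (0 : ℝ) (2 * π))
    (hy : y ∈ Set.Ico (0 : ℝ) (2 * π)) (hc : Real.cos x = Real.cos y)
    (hs : Real.sin x = Real.sin y) : x = y := by
  obtain ⟨k, hk⟩ := Real.Angle.angle_eq_iff_two_pi_dvd_sub.1 (Real.Angle.cos_sin_inj hc hs)
  obtain ⟨hx0, hx1⟩ := hx
  obtain ⟨hy0, hy1⟩ := hy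
  have hpi := Real.pi_pos
  have h1 : (k : ℝ) < 1 := by nlinarith
  have h2 : (-1 : ℝ) < k := by nlinarith
  have h3 : k < 1 := by exact_mod_cast h1
  have h4 : -1 < k := by exact_mod_cast h2
  obtain rfl : k = 0 := by omega
  simpa [sub_eq_zero] using hk

/-- The equality case of `sin a + sin b - sin (a + b) ≤ 3√3/2`, which follows from
`√3 · sin a · (1 - cos b) ≤ (3 sin² a + (1 - cos b)²) / 2` and its mirror image. -/
theorem cos_sin_of_sin_add_sin_sub_sin_add_eq {a b : ℝ}
    (h : Real.sin a + Real.sin b - Real.sin (a + b) = 3 * Real.sqrt 3 / 2) :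
    (Real.cos a = -(1 / 2) ∧ Real.sin a = Real.sqrt 3 / 2) ∧
      Real.cos (a + b) = -(1 / 2) ∧ Real.sin (a + b) = -(Real.sqrt 3 / 2) := by
  rw [Real.sin_add] at h
  rw [Real.sin_add, Real.cos_add]
  have ha := Real.sin_sq_add_cos_sq a
  have hb := Real.sin_sq_add_cos_sq b
  have hk : Real.sqrt 3 ^ 2 = 3 := Real.sq_sqrt (by norm_num)
  have hk0 : 0 < Real.sqrt 3 := by positivity
  generalize Real.sqrt 3 = k at *
  generalize Real.cos a = p at *
  generalize Real.sin a = q at *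
  generalize Real.cos b = r at *
  generalize Real.sin b = s at *
  have key : (p + 1 / 2) ^ 2 + (r + 1 / 2) ^ 2
      + (k * q - (1 - r)) ^ 2 / 2 + (k * s - (1 - p)) ^ 2 / 2 = 0 := by
    linear_combination (3 / 2) * ha + (3 / 2) * hb - k * h + ((q ^ 2 + s ^ 2 - 3) / 2) * hk
  have hp : p = -(1 / 2) := by
    have : (p + 1 / 2) ^ 2 = 0 := by nlinarith
    linarith [pow_eq_zero_iff two_ne_zero |>.1 this]
  have hr : r = -(1 / 2) := by
    have : (r + 1 / 2) ^ 2 = 0 := by nlinarith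
    linarith [pow_eq_zero_iff two_ne_zero |>.1 this]
  subst hp hr
  have hq : q = k / 2 := by
    have : (k * q - (1 - -(1 / 2))) ^ 2 = 0 := by nlinarith
    have := pow_eq_zero_iff two_ne_zero |>.1 this
    exact mul_left_cancel₀ hk0.ne' (by linarith)
  have hs : s = k / 2 := by linarith
  subst hq hs
  refine ⟨⟨rfl, rfl⟩, ?_, ?_⟩ <;> linarith

/-- On `[0,2π) × [0,2π)` the function `f` attains its minimum `-3√3/2` exactly at
`(4π/3, 2π/3)` and its maximum `3√3/2` exactly at `(2π/3, 4π/3)`. -/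
theorem stmt_3 :
    f (4 * π / 3) (2 * π / 3) = -(3 * Real.sqrt 3 / 2) ∧
    f (2 * π / 3) (4 * π / 3) = 3 * Real.sqrt 3 / 2 ∧
    (∀ θ₁ ∈ Set.Ico (0 : ℝ) (2 * π), ∀ θ₂ ∈ Set.Ico (0 : ℝ) (2 * π),
      (f θ₁ θ₂ = -(3 * Real.sqrt 3 / 2) → θ₁ = 4 * π / 3 ∧ θ₂ = 2 * π / 3) ∧
      (f θ₁ θ₂ = 3 * Real.sqrt 3 / 2 → θ₁ = 2 * π / 3 ∧ θ₂ = 4 * π / 3)) := by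
  have h2 : 2 * π / 3 ∈ Set.Ico (0 : ℝ) (2 * π) := by
    constructor <;> linarith [Real.pi_pos]
  have h4 : 4 * π / 3 ∈ Set.Ico (0 : ℝ) (2 * π) := by
    constructor <;> linarith [Real.pi_pos]
  refine ⟨?_, ?_, fun x hx y hy => ⟨fun h => ?_, fun h => ?_⟩⟩
  · rw [f, show 2 * π / 3 - 4 * π / 3 = -(2 * π / 3) by ring, Real.sin_neg,
      sin_two_pi_div_three, sin_four_pi_div_three]
    ring
  · rw [f, show 4 * π / 3 - 2 * π / 3 = 2 * π / 3 by ring,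
      sin_two_pi_div_three, sin_four_pi_div_three]
    ring
  · have h' : Real.sin (-x) + Real.sin (x - y) - Real.sin (-x + (x - y))
        = 3 * Real.sqrt 3 / 2 := by
      rw [show -x + (x - y) = -y by ring, show x - y = -(y - x) by ring]
      simp only [Real.sin_neg]
      rw [f] at h
      linarith
    obtain ⟨⟨hcx, hsx⟩, hcy, hsy⟩ := cos_sin_of_sin_add_sin_sub_sin_add_eq h'
    rw [show -x + (x - y) = -y by ring] at hcy hsy
    rw [Real.cos_neg] at hcx hcy
    rw [Real.sin_neg] at hsx hsy
    exact ⟨eq_of_cos_eq_of_sin_eq hx h4 (by rw [hcx, cos_four_pi_div_three])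
        (by rw [sin_four_pi_div_three]; linarith),
      eq_of_cos_eq_of_sin_eq hy h2 (by rw [hcy, cos_two_pi_div_three])
        (by rw [sin_two_pi_div_three]; linarith)⟩
  · have h' : Real.sin x + Real.sin (y - x) - Real.sin (x + (y - x))
        = 3 * Real.sqrt 3 / 2 := by
      rwa [add_sub_cancel]
    obtain ⟨⟨hcx, hsx⟩, hcy, hsy⟩ := cos_sin_of_sin_add_sin_sub_sin_add_eq h'
    rw [add_sub_cancel] at hcy hsy
    exact ⟨eq_of_cos_eq_of_sin_eq hx h2 (by rw [hcx, cos_two_pi_div_three])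
        (by rw [hsx, sin_two_pi_div_three]),
      eq_of_cos_eq_of_sin_eq hy h4 (by rw [hcy, cos_four_pi_div_three])
        (by rw [hsy, sin_four_pi_div_three])⟩
end

section
/- For all (θ₁, θ₂) ∈ (0, 2π) × (0, 2π), the two equations cos(θ₁) = cos(θ₂ − θ₁) and cos(θ₂ − θ₁) = cos(θ₂) hold simultaneously if and only if (θ₁, θ₂) = (2π/3, 4π/3) or (θ₁, θ₂) = (4π/3, 2π/3). -/
open Real

/-- Bounds on an integer multiple of `π` transfer to the integer. -/
theorem int_bounds_of_mul_pi {a b n : ℤ} (ha : (a : ℝ) * π < n * π) (hb : (n : ℝ) * π < b * π) :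
    a < n ∧ n < b :=
  ⟨by exact_mod_cast lt_of_mul_lt_mul_right ha pi_pos.le,
    by exact_mod_cast lt_of_mul_lt_mul_right hb pi_pos.le⟩

/-- For `(θ₁,θ₂) ∈ (0,2π) × (0,2π)` the equations `cos θ₁ = cos (θ₂ - θ₁)` and
`cos (θ₂ - θ₁) = cos θ₂` hold simultaneously iff `(θ₁,θ₂) = (2π/3, 4π/3)` or
`(θ₁,θ₂) = (4π/3, 2π/3)`. -/
theorem stmt_5 (θ₁ θ₂ : ℝ) (h₁ : θ₁ ∈ Set.Ioo 0 (2 * π)) (h₂ : θ₂ ∈ Set.Ioo 0 (2 * π)) :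
    (Real.cos θ₁ = Real.cos (θ₂ - θ₁) ∧ Real.cos (θ₂ - θ₁) = Real.cos θ₂) ↔
      ((θ₁ = 2 * π / 3 ∧ θ₂ = 4 * π / 3) ∨ (θ₁ = 4 * π / 3 ∧ θ₂ = 2 * π / 3)) := by
  obtain ⟨h₁l, h₁u⟩ := h₁
  obtain ⟨h₂l, h₂u⟩ := h₂
  constructor
  · rintro ⟨h, h'⟩
    obtain ⟨k, hk | hk⟩ := Real.cos_eq_cos_iff.1 h
    · obtain ⟨m, hm | hm⟩ := Real.cos_eq_cos_iff.1 h'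
      · have := int_bounds_of_mul_pi (a := 0) (b := 2) (n := 2 * m)
          (by push_cast; linarith) (by push_cast; linarith)
        omega
      · have hn := int_bounds_of_mul_pi (a := 0) (b := 6) (n := 2 * (m - 2 * k))
          (by push_cast; linarith) (by push_cast; linarith)
        have hkn := int_bounds_of_mul_pi (a := 0) (b := 6) (n := 6 * k + 4 * (m - 2 * k))
          (by push_cast; linarith) (by push_cast; linarith)
        obtain ⟨rfl, rfl⟩ | ⟨rfl, rfl⟩ : (k = 0 ∧ m = 1) ∨ (k = -1 ∧ m = 0) := by omega
        · left
          push_cast at hk hm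
          constructor <;> linarith
        · right
          push_cast at hk hm
          constructor <;> linarith
    · have := int_bounds_of_mul_pi (a := 0) (b := 2) (n := 2 * k)
        (by push_cast; linarith) (by push_cast; linarith)
      omega
  · have hcos : Real.cos (4 * π / 3) = Real.cos (2 * π / 3) := by
      rw [← Real.cos_two_pi_sub]
      congr 1
      ring
    rintro (⟨rfl, rfl⟩ | ⟨rfl, rfl⟩)
    · have hsub : 4 * π / 3 - 2 * π / 3 = 2 * π / 3 := by ring
      rw [hsub, hcos]
      exact ⟨rfl, rfl⟩
    · have hsub : 2 * π / 3 - 4 * π / 3 = -(2 * π / 3) := by ring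
      rw [hsub, Real.cos_neg, hcos]
      exact ⟨rfl, rfl⟩
end

section
/- For all unit vectors a, b, c ∈ S¹ ⊂ ℝ² one has |a × b + b × c + c × a| ≤ 3√3/2, and equality holds if and only if a + b + c = 0. -/
open Real

/-- The scalar cross product `a × b = a₁b₂ - a₂b₁` of two vectors of `ℝ²`. -/
noncomputable def cross (a b : EuclideanSpace ℝ (Fin 2)) : ℝ := a 0 * b 1 - a 1 * b 0

lemma sq_add_sq_of_norm_eq_one {a : EuclideanSpace ℝ (Fin 2)} (ha : ‖a‖ = 1) :
    a 0 ^ 2 + a 1 ^ 2 = 1 := by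
  have h := EuclideanSpace.real_norm_sq_eq a
  rw [ha, Fin.sum_univ_two] at h
  linarith

/-- Reversing the cyclic order flips the sign of the sum of cross products. -/
lemma cross_cyclic_swap (a b c : EuclideanSpace ℝ (Fin 2)) :
    cross a c + cross c b + cross b a = -(cross a b + cross b c + cross c a) := by
  simp only [cross]
  ring

/-- The deficit in the bound dominates `|a + b + c|²`. The remainder in the sum of squares is
the squared length of a discrete Fourier coefficient of `(a, b, c)`. -/
lemma cross_cyclic_add_le {a b c : EuclideanSpace ℝ (Fin 2)} (ha : ‖a‖ = 1) (hb : ‖b‖ = 1)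
    (hc : ‖c‖ = 1) :
    cross a b + cross b c + cross c a
      + √3 / 6 * ((a 0 + b 0 + c 0) ^ 2 + (a 1 + b 1 + c 1) ^ 2) ≤ 3 * √3 / 2 := by
  have ha' := sq_add_sq_of_norm_eq_one ha
  have hb' := sq_add_sq_of_norm_eq_one hb
  have hc' := sq_add_sq_of_norm_eq_one hc
  have hs : √3 ^ 2 = 3 := Real.sq_sqrt (by norm_num)
  have hpos : 0 ≤ √3 / 3 *
      ((a 0 - b 0 / 2 - c 0 / 2 - √3 / 2 * (b 1 - c 1)) ^ 2
        + (a 1 - b 1 / 2 - c 1 / 2 + √3 / 2 * (b 0 - c 0)) ^ 2) := by positivity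
  simp only [cross]
  generalize √3 = s at *
  have hs3 : s ^ 3 = 3 * s := by rw [pow_succ, hs]
  ring_nf at hpos ⊢
  simp only [hs, hs3] at hpos
  linear_combination hpos + s / 2 * (ha' + hb' + hc')

theorem stmt_6 (a b c : EuclideanSpace ℝ (Fin 2)) (ha : ‖a‖ = 1) (hb : ‖b‖ = 1)
    (hc : ‖c‖ = 1) :
    |cross a b + cross b c + cross c a| ≤ 3 * Real.sqrt 3 / 2 ∧
    (|cross a b + cross b c + cross c a| = 3 * Real.sqrt 3 / 2 ↔ a + b + c = 0) := by
  have h₁ := cross_cyclic_add_le ha hb hc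
  have h₂ := cross_cyclic_add_le ha hc hb
  rw [cross_cyclic_swap, add_right_comm (a 0), add_right_comm (a 1)] at h₂
  have hs : 0 < √3 := by positivity
  have hdeficit : |cross a b + cross b c + cross c a|
      + √3 / 6 * ((a 0 + b 0 + c 0) ^ 2 + (a 1 + b 1 + c 1) ^ 2) ≤ 3 * √3 / 2 := by
    rcases abs_cases (cross a b + cross b c + cross c a) with h | h <;> rw [h.1] <;> assumption
  refine ⟨le_trans (le_add_of_nonneg_right (by positivity)) hdeficit, fun h => ?_, fun h => ?_⟩
  · have hsum : (a 0 + b 0 + c 0) ^ 2 + (a 1 + b 1 + c 1) ^ 2 ≤ 0 := by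
      by_contra! hlt
      have := mul_pos (div_pos hs (by norm_num : (0 : ℝ) < 6)) hlt
      linarith
    ext i
    fin_cases i
    · simpa using (by nlinarith [sq_nonneg (a 1 + b 1 + c 1)] : a 0 + b 0 + c 0 = 0)
    · simpa using (by nlinarith [sq_nonneg (a 0 + b 0 + c 0)] : a 1 + b 1 + c 1 = 0)
  · have h0 : a 0 + b 0 + c 0 = 0 := by simpa using congrArg (fun v => v 0) h
    have h1 : a 1 + b 1 + c 1 = 0 := by simpa using congrArg (fun v => v 1) h
    have ha' := sq_add_sq_of_norm_eq_one ha
    have hb' := sq_add_sq_of_norm_eq_one hb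
    have hc' := sq_add_sq_of_norm_eq_one hc
    have hc0 : c 0 = -(a 0 + b 0) := by linarith
    have hc1 : c 1 = -(a 1 + b 1) := by linarith
    have hdot : a 0 * b 0 + a 1 * b 1 = -1 / 2 := by
      rw [hc0, hc1] at hc'
      linarith
    have hsq : (a 0 * b 1 - a 1 * b 0) ^ 2 = 3 / 4 := by
      linear_combination (b 0 ^ 2 + b 1 ^ 2) * ha' + hb'
        - (a 0 * b 0 + a 1 * b 1 - 1 / 2) * hdot
    rw [← abs_of_nonneg (by positivity : 0 ≤ 3 * √3 / 2), ← sq_eq_sq_iff_abs_eq_abs]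
    have h3 : √3 ^ 2 = 3 := Real.sq_sqrt (by norm_num)
    simp only [cross, hc0, hc1]
    linear_combination 9 * hsq - 9 / 4 * h3
end

section
/- For every δ ∈ (0, 1) there exists a constant C_δ > 0 such that for all unit vectors a, b, c ∈ S¹ ⊂ ℝ² satisfying |a × b + b × c + c × a| ≤ (3√3/2)(1 − δ), one has |a + b + c|² ≥ C_δ. -/
open Real

/-- For a unit vector `c`, the inner product of any `s` with `c` is at most `|s|` (squared form). -/
lemma sq_dot_le {s₀ s₁ c₀ c₁ : ℝ} (hc : c₀ ^ 2 + c₁ ^ 2 = 1) :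
    (s₀ * c₀ + s₁ * c₁) ^ 2 ≤ s₀ ^ 2 + s₁ ^ 2 := by
  have h : (s₀ ^ 2 + s₁ ^ 2) * (c₀ ^ 2 + c₁ ^ 2) =
      (s₀ * c₀ + s₁ * c₁) ^ 2 + (s₀ * c₁ - s₁ * c₀) ^ 2 := by ring
  rw [hc] at h
  nlinarith [sq_nonneg (s₀ * c₁ - s₁ * c₀)]

/-- If three unit vectors have a small sum, any two of them have inner product close to `-1/2`. -/
lemma sq_dot_add_half_le {a₀ a₁ b₀ b₁ c₀ c₁ E : ℝ} (ha : a₀ ^ 2 + a₁ ^ 2 = 1)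
    (hb : b₀ ^ 2 + b₁ ^ 2 = 1) (hc : c₀ ^ 2 + c₁ ^ 2 = 1)
    (hE : E = (a₀ + b₀ + c₀) ^ 2 + (a₁ + b₁ + c₁) ^ 2) (hE1 : E ≤ 1) :
    (a₀ * b₀ + a₁ * b₁ + 1 / 2) ^ 2 ≤ 5 / 2 * E := by
  have hd := sq_dot_le (s₀ := a₀ + b₀ + c₀) (s₁ := a₁ + b₁ + c₁) hc
  rw [← hE] at hd
  have hE0 : 0 ≤ E := by rw [hE]; positivity
  set d := (a₀ + b₀ + c₀) * c₀ + (a₁ + b₁ + c₁) * c₁ with hd'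
  have hx : a₀ * b₀ + a₁ * b₁ + 1 / 2 = E / 2 - d := by
    rw [hE, hd']
    linear_combination (-1 / 2) * ha + (-1 / 2) * hb + (1 / 2) * hc
  rw [hx]
  nlinarith [sq_nonneg (E / 2 + d), mul_nonneg hE0 (sub_nonneg.2 hE1)]

/-- Three unit vectors of small energy have nearly extremal chirality. -/
lemma sq_chirality_ge {a₀ a₁ b₀ b₁ c₀ c₁ E : ℝ} (ha : a₀ ^ 2 + a₁ ^ 2 = 1)
    (hb : b₀ ^ 2 + b₁ ^ 2 = 1) (hc : c₀ ^ 2 + c₁ ^ 2 = 1)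
    (hE : E = (a₀ + b₀ + c₀) ^ 2 + (a₁ + b₁ + c₁) ^ 2) (hE1 : E ≤ 1) :
    27 / 4 - 33 / 2 * E ≤
      ((a₀ * b₁ - a₁ * b₀) + (b₀ * c₁ - b₁ * c₀) + (c₀ * a₁ - c₁ * a₀)) ^ 2 := by
  have hp := sq_dot_add_half_le ha hb hc hE hE1
  have hq := sq_dot_add_half_le hb hc ha (E := E) (by rw [hE]; ring) hE1
  have hr := sq_dot_add_half_le hc ha hb (E := E) (by rw [hE]; ring) hE1
  have hu : (b₀ - a₀) ^ 2 + (b₁ - a₁) ^ 2 = 2 - 2 * (a₀ * b₀ + a₁ * b₁) := by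
    linear_combination ha + hb
  have hv : (c₀ - a₀) ^ 2 + (c₁ - a₁) ^ 2 = 2 - 2 * (c₀ * a₀ + c₁ * a₁) := by
    linear_combination ha + hc
  have huv : (b₀ - a₀) * (c₀ - a₀) + (b₁ - a₁) * (c₁ - a₁) =
      (b₀ * c₀ + b₁ * c₁) - (a₀ * b₀ + a₁ * b₁) - (c₀ * a₀ + c₁ * a₁) + 1 := by
    linear_combination ha
  have hX : ((a₀ * b₁ - a₁ * b₀) + (b₀ * c₁ - b₁ * c₀) + (c₀ * a₁ - c₁ * a₀)) ^ 2 =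
      ((b₀ - a₀) ^ 2 + (b₁ - a₁) ^ 2) * ((c₀ - a₀) ^ 2 + (c₁ - a₁) ^ 2) -
        ((b₀ - a₀) * (c₀ - a₀) + (b₁ - a₁) * (c₁ - a₁)) ^ 2 := by ring
  have hS : E = 3 + 2 * ((a₀ * b₀ + a₁ * b₁) + (b₀ * c₀ + b₁ * c₁) + (c₀ * a₀ + c₁ * a₁)) := by
    rw [hE]
    linear_combination ha + hb + hc
  rw [hX, hu, hv, huv]
  generalize a₀ * b₀ + a₁ * b₁ = p at *
  generalize b₀ * c₀ + b₁ * c₁ = q at *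
  generalize c₀ * a₀ + c₁ * a₁ = r at *
  have key : (2 - 2 * p) * (2 - 2 * r) - (q - p - r + 1) ^ 2 = 27 / 4 - 3 / 2 * E + E ^ 2 / 4 -
      2 * ((p + 1 / 2) ^ 2 + (q + 1 / 2) ^ 2 + (r + 1 / 2) ^ 2) := by
    rw [hS]; ring
  rw [key]
  nlinarith [sq_nonneg E]

/-- For every `δ ∈ (0,1)` there is `C_δ > 0` such that for all unit vectors `a, b, c ∈ S¹`
with `|a×b + b×c + c×a| ≤ (3√3/2)(1-δ)` one has `|a + b + c|² ≥ C_δ`. -/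
theorem stmt_7 (δ : ℝ) (hδ : δ ∈ Set.Ioo (0 : ℝ) 1) :
    ∃ C : ℝ, 0 < C ∧
      ∀ a b c : EuclideanSpace ℝ (Fin 2), ‖a‖ = 1 → ‖b‖ = 1 → ‖c‖ = 1 →
        |cross a b + cross b c + cross c a| ≤ 3 * Real.sqrt 3 / 2 * (1 - δ) →
        C ≤ ‖a + b + c‖ ^ 2 := by
  obtain ⟨h0, h1⟩ := hδ
  refine ⟨δ / 3, by positivity, fun a b c ha hb hc h => ?_⟩
  have unit : ∀ v : EuclideanSpace ℝ (Fin 2), ‖v‖ = 1 → v 0 ^ 2 + v 1 ^ 2 = 1 := by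
    intro v hv
    have := EuclideanSpace.real_norm_sq_eq v
    rw [hv, Fin.sum_univ_two] at this
    linarith
  have hE : ‖a + b + c‖ ^ 2 = (a 0 + b 0 + c 0) ^ 2 + (a 1 + b 1 + c 1) ^ 2 := by
    rw [EuclideanSpace.real_norm_sq_eq, Fin.sum_univ_two]
    simp
  by_contra! hlt
  have hX := sq_chirality_ge (unit a ha) (unit b hb) (unit c hc) hE (by linarith)
  have hsq := pow_le_pow_left₀ (abs_nonneg _) h 2
  rw [sq_abs] at hsq
  simp only [cross] at hsq
  have h3 : (3 * Real.sqrt 3 / 2 * (1 - δ)) ^ 2 = 27 / 4 * (1 - δ) ^ 2 := by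
    rw [mul_pow, div_pow, mul_pow, Real.sq_sqrt (by norm_num)]
    ring
  rw [h3] at hsq
  nlinarith
end

section
/- For all θ₁, θ₂ ∈ [0, 2π): f(θ₁, θ₂) > 0 if and only if 0 < θ₁ < θ₂, and f(θ₁, θ₂) < 0 if and only if 0 < θ₂ < θ₁. (In other words, a positive chirality of a triple (u, u·e^{iθ₁}, u·e^{iθ₂}) of unit vectors corresponds to a counterclockwise ordering on S¹, and a negative chirality to a clockwise ordering.) -/
open Real

theorem f_eq_four_mul_sin_half (x y : ℝ) :
    f x y = 4 * (Real.sin (x / 2) * Real.sin (y / 2) * Real.sin (y / 2 - x / 2)) := by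
  obtain ⟨a, rfl⟩ : ∃ a, x = 2 * a := ⟨x / 2, by ring⟩
  obtain ⟨b, rfl⟩ : ∃ b, y = 2 * b := ⟨y / 2, by ring⟩
  have ha : 2 * a / 2 = a := by ring
  have hb : 2 * b / 2 = b := by ring
  rw [f, ha, hb, ← mul_sub, Real.sin_two_mul, Real.sin_two_mul, Real.sin_two_mul,
    Real.sin_sub, Real.cos_sub]
  linear_combination
    -2 * Real.sin a * Real.cos a * Real.sin_sq_add_cos_sq b +
      2 * Real.sin b * Real.cos b * Real.sin_sq_add_cos_sq a

theorem f_swap (x y : ℝ) : f y x = -f x y := by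
  rw [f, f, ← neg_sub y x, Real.sin_neg]
  ring

theorem f_pos_of_lt {x y : ℝ} (hx : 0 < x) (hxy : x < y) (hy : y < 2 * π) : 0 < f x y := by
  rw [f_eq_four_mul_sin_half]
  have h₁ : 0 < Real.sin (x / 2) := Real.sin_pos_of_pos_of_lt_pi (by linarith) (by linarith)
  have h₂ : 0 < Real.sin (y / 2) := Real.sin_pos_of_pos_of_lt_pi (by linarith) (by linarith)
  have h₃ : 0 < Real.sin (y / 2 - x / 2) :=
    Real.sin_pos_of_pos_of_lt_pi (by linarith) (by linarith)
  positivity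

/-- For all `θ₁, θ₂ ∈ [0, 2π)`: `f(θ₁,θ₂) > 0 ↔ 0 < θ₁ < θ₂` and
`f(θ₁,θ₂) < 0 ↔ 0 < θ₂ < θ₁`. -/
theorem stmt_8 (θ₁ θ₂ : ℝ) (h₁ : θ₁ ∈ Set.Ico 0 (2 * π)) (h₂ : θ₂ ∈ Set.Ico 0 (2 * π)) :
    (0 < f θ₁ θ₂ ↔ 0 < θ₁ ∧ θ₁ < θ₂) ∧ (f θ₁ θ₂ < 0 ↔ 0 < θ₂ ∧ θ₂ < θ₁) := by
  obtain ⟨h₁, h₁'⟩ := h₁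
  obtain ⟨h₂, h₂'⟩ := h₂
  rcases h₁.eq_or_lt with rfl | h₁
  · simp [f, h₂.not_gt]
  rcases h₂.eq_or_lt with rfl | h₂
  · simp [f, h₁.not_gt]
  rcases lt_trichotomy θ₁ θ₂ with h | rfl | h
  · have hf := f_pos_of_lt h₁ h h₂'
    simp [hf, hf.not_gt, h₁, h, h.not_gt]
  · simp [f]
  · have hf : f θ₁ θ₂ < 0 := by
      rw [f_swap, neg_lt_zero]
      exact f_pos_of_lt h₂ h h₁'
    simp [hf, hf.not_gt, h₂, h, h.not_gt]
end

section
/- For all θ₁, θ₂, θ₃ ∈ [0, 2π) with θ₁ ≤ θ₂ ≤ θ₃ one has 6 + 2(g(θ₁, θ₂) + g(θ₃, θ₂)) ≥ 5/3, i.e. g(θ₁, θ₂) + g(θ₃, θ₂) ≥ −13/6. -/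
open Real

/-- `g(θ₁,θ₂) = cos θ₁ + cos (θ₂ - θ₁) + cos θ₂`. -/
noncomputable def g (θ₁ θ₂ : ℝ) : ℝ := Real.cos θ₁ + Real.cos (θ₂ - θ₁) + Real.cos θ₂

theorem g_eq_half_angle (a b : ℝ) :
    g a b = 2 * cos (b / 2) * cos (a - b / 2) + 2 * cos (b / 2) ^ 2 - 1 := by
  have h1 := cos_add_cos a (b - a)
  have h2 := cos_sq (b / 2)
  rw [show (a + (b - a)) / 2 = b / 2 by ring, show (a - (b - a)) / 2 = a - b / 2 by ring] at h1
  rw [show 2 * (b / 2) = b by ring] at h2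
  unfold g
  linarith

theorem cos_sub_half_sub_cos_half (a b : ℝ) :
    cos (a - b / 2) - cos (b / 2) = 2 * sin (a / 2) * sin ((b - a) / 2) := by
  rw [cos_sub_cos, show (a - b / 2 + b / 2) / 2 = a / 2 by ring,
    show (a - b / 2 - b / 2) / 2 = -((b - a) / 2) by ring, sin_neg]
  ring

/-- For all `θ₁, θ₂, θ₃ ∈ [0, 2π)` with `θ₁ ≤ θ₂ ≤ θ₃` one has
`6 + 2(g(θ₁,θ₂) + g(θ₃,θ₂)) ≥ 5/3`. -/
theorem stmt_9 (θ₁ θ₂ θ₃ : ℝ) (h₁ : θ₁ ∈ Set.Ico 0 (2 * π)) (h₂ : θ₂ ∈ Set.Ico 0 (2 * π))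
    (h₃ : θ₃ ∈ Set.Ico 0 (2 * π)) (h₁₂ : θ₁ ≤ θ₂) (h₂₃ : θ₂ ≤ θ₃) :
    5 / 3 ≤ 6 + 2 * (g θ₁ θ₂ + g θ₃ θ₂) := by
  obtain ⟨h₁0, h₁π⟩ := h₁
  obtain ⟨h₂0, h₂π⟩ := h₂
  obtain ⟨h₃0, h₃π⟩ := h₃
  rw [g_eq_half_angle, g_eq_half_angle]
  have hlo : 0 ≤ cos (θ₁ - θ₂ / 2) - cos (θ₂ / 2) := by
    rw [cos_sub_half_sub_cos_half]
    have := sin_nonneg_of_nonneg_of_le_pi (x := θ₁ / 2) (by linarith) (by linarith)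
    have := sin_nonneg_of_nonneg_of_le_pi (x := (θ₂ - θ₁) / 2) (by linarith) (by linarith)
    positivity
  have hhi : cos (θ₃ - θ₂ / 2) - cos (θ₂ / 2) ≤ 0 := by
    rw [cos_sub_half_sub_cos_half]
    have := sin_nonneg_of_nonneg_of_le_pi (x := θ₃ / 2) (by linarith) (by linarith)
    have := sin_nonpos_of_nonpos_of_neg_pi_le (x := (θ₂ - θ₃) / 2) (by linarith) (by linarith)
    exact mul_nonpos_of_nonneg_of_nonpos (by positivity) this
  rcases le_total 0 (cos (θ₂ / 2)) with hx | hx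
  · have := mul_nonneg hx hlo
    have := mul_nonneg hx (sub_nonneg.2 (neg_one_le_cos (θ₃ - θ₂ / 2)))
    nlinarith [sq_nonneg (cos (θ₂ / 2) - 1 / 6)]
  · have := mul_nonneg_of_nonpos_of_nonpos hx hhi
    have := mul_nonneg_of_nonpos_of_nonpos hx (sub_nonpos.2 (cos_le_one (θ₁ - θ₂ / 2)))
    nlinarith [sq_nonneg (cos (θ₂ / 2) + 1 / 6)]
end

section
/- Let a, b, c, d ∈ S¹ ⊂ ℝ² be unit vectors such that a × b + b × c + c × a ≥ 0 and a × d + d × c + c × a ≤ 0. Then |a + b + c|² + |a + d + c|² ≥ 5/3. (This is the energetic cost of a chirality change between two lattice triangles sharing the side with spin values a and c, where b and d are the spin values at the remaining two vertices.) -/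
open Real

/-- A unit vector `d` and any `p` satisfy `3|p|² + 2 p·d + 1/3 = |3p + d|² / 3 ≥ 0`; adding a second
unit vector `b` with `p·b ≥ |p|²/2` bounds the total energy from below. -/
lemma five_thirds_le_of_inner_ge {p₀ p₁ b₀ b₁ d₀ d₁ : ℝ} (hb : b₀ ^ 2 + b₁ ^ 2 = 1)
    (hd : d₀ ^ 2 + d₁ ^ 2 = 1) (h : p₀ ^ 2 + p₁ ^ 2 ≤ 2 * (p₀ * b₀ + p₁ * b₁)) :
    5 / 3 ≤ ((p₀ + b₀) ^ 2 + (p₁ + b₁) ^ 2) + ((p₀ + d₀) ^ 2 + (p₁ + d₁) ^ 2) := by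
  nlinarith [sq_nonneg (3 * p₀ + d₀), sq_nonneg (3 * p₁ + d₁)]

/-- For unit vectors `a ≠ c`, the vectors `a + c` and `c - a` are orthogonal, so a point `b` on the
same side of the line through `a` and `c` as `a + c` satisfies `(a + c)·b ≥ |a + c|²/2`. -/
lemma normSq_add_le_two_mul_inner {a₀ a₁ b₀ b₁ c₀ c₁ : ℝ} (ha : a₀ ^ 2 + a₁ ^ 2 = 1)
    (hc : c₀ ^ 2 + c₁ ^ 2 = 1) (hq : 0 < (c₀ - a₀) ^ 2 + (c₁ - a₁) ^ 2)
    (h : 0 ≤ ((b₀ - a₀) * (c₁ - a₁) - (b₁ - a₁) * (c₀ - a₀)) * (a₀ * c₁ - a₁ * c₀)) :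
    (a₀ + c₀) ^ 2 + (a₁ + c₁) ^ 2 ≤ 2 * ((a₀ + c₀) * b₀ + (a₁ + c₁) * b₁) := by
  have horth : (a₀ + c₀) * (c₀ - a₀) + (a₁ + c₁) * (c₁ - a₁) = 0 := by linarith
  have key : ((b₀ - a₀) * (c₁ - a₁) - (b₁ - a₁) * (c₀ - a₀)) * (2 * (a₀ * c₁ - a₁ * c₀)) =
      ((c₀ - a₀) ^ 2 + (c₁ - a₁) ^ 2) * ((a₀ + c₀) * (b₀ - a₀) + (a₁ + c₁) * (b₁ - a₁)) := by
    linear_combination -((b₀ - a₀) * (c₀ - a₀) + (b₁ - a₁) * (c₁ - a₁)) * horth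
  have hnonneg : 0 ≤ (a₀ + c₀) * (b₀ - a₀) + (a₁ + c₁) * (b₁ - a₁) :=
    nonneg_of_mul_nonneg_right (by linarith) hq
  linarith

/-- If `a, b, c, d ∈ S¹ ⊂ ℝ²` are unit vectors with `a×b + b×c + c×a ≥ 0` and
`a×d + d×c + c×a ≤ 0`, then `|a+b+c|² + |a+d+c|² ≥ 5/3`. -/
theorem stmt_10 (a b c d : EuclideanSpace ℝ (Fin 2)) (ha : ‖a‖ = 1) (hb : ‖b‖ = 1)
    (hc : ‖c‖ = 1) (hd : ‖d‖ = 1)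
    (hpos : 0 ≤ cross a b + cross b c + cross c a)
    (hneg : cross a d + cross d c + cross c a ≤ 0) :
    5 / 3 ≤ ‖a + b + c‖ ^ 2 + ‖a + d + c‖ ^ 2 := by
  have hunit : ∀ x : EuclideanSpace ℝ (Fin 2), ‖x‖ = 1 → x 0 ^ 2 + x 1 ^ 2 = 1 := by
    intro x hx
    simpa [hx] using (EuclideanSpace.real_norm_sq_eq x).symm
  have ha' := hunit a ha
  have hb' := hunit b hb
  have hc' := hunit c hc
  have hd' := hunit d hd
  rw [add_right_comm a b c, add_right_comm a d c, EuclideanSpace.real_norm_sq_eq,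
    EuclideanSpace.real_norm_sq_eq]
  simp only [Fin.sum_univ_two, PiLp.add_apply]
  unfold cross at hpos hneg
  have hpos' : 0 ≤ (b 0 - a 0) * (c 1 - a 1) - (b 1 - a 1) * (c 0 - a 0) := by linarith
  have hneg' : (d 0 - a 0) * (c 1 - a 1) - (d 1 - a 1) * (c 0 - a 0) ≤ 0 := by linarith
  rcases (add_nonneg (sq_nonneg (c 0 - a 0)) (sq_nonneg (c 1 - a 1))).eq_or_lt with hq | hq
  · have h0 : c 0 = a 0 := by nlinarith [sq_nonneg (c 0 - a 0), sq_nonneg (c 1 - a 1)]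
    have h1 : c 1 = a 1 := by nlinarith [sq_nonneg (c 0 - a 0), sq_nonneg (c 1 - a 1)]
    rw [h0, h1]
    nlinarith [sq_nonneg (a 0 + b 0), sq_nonneg (a 1 + b 1), sq_nonneg (a 0 + d 0),
      sq_nonneg (a 1 + d 1)]
  · rcases le_total 0 (a 0 * c 1 - a 1 * c 0) with hs | hs
    · exact five_thirds_le_of_inner_ge hb' hd'
        (normSq_add_le_two_mul_inner ha' hc' hq (mul_nonneg hpos' hs))
    · rw [add_comm (_ + _)]
      exact five_thirds_le_of_inner_ge hd' hb'
        (normSq_add_le_two_mul_inner ha' hc' hq (mul_nonneg_of_nonpos_of_nonpos hneg' hs))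
end

section
/- For every φ ∈ ℝ with |φ − 2π/3| ≤ 1/2 one has (1/3)(φ − 2π/3)² ≤ 1 + 2cos(φ) + √3(φ − 2π/3) ≤ (2/3)(φ − 2π/3)². Analogously, for every φ ∈ ℝ with |φ − 4π/3| ≤ 1/2 one has (1/3)(φ − 4π/3)² ≤ 1 + 2cos(φ) − √3(φ − 4π/3) ≤ (2/3)(φ − 4π/3)². -/
open Real

theorem one_sub_cos_add_sqrt_three_mul_bounds {x : ℝ} (hx : |x| ≤ 1 / 2) :
    1 / 3 * x ^ 2 ≤ 1 - Real.cos x + Real.sqrt 3 * (x - Real.sin x) ∧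
      1 - Real.cos x + Real.sqrt 3 * (x - Real.sin x) ≤ 2 / 3 * x ^ 2 := by
  have hcos := (abs_le.mp (Real.cos_bound (hx.trans (by norm_num)))).2
  have hcos' := Real.one_sub_sq_div_two_le_cos (x := x)
  have hsqrt : Real.sqrt 3 ≤ 7 / 4 := by
    rw [Real.sqrt_le_left (by norm_num)]
    norm_num
  have hsin : |Real.sqrt 3 * (x - Real.sin x)| ≤ 7 / 48 * x ^ 2 := by
    rw [abs_mul, abs_of_nonneg (Real.sqrt_nonneg 3)]
    calc
      Real.sqrt 3 * |x - Real.sin x| ≤ 7 / 4 * (|x| ^ 3 / 6) :=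
        mul_le_mul hsqrt (Real.abs_sub_sin_le x) (abs_nonneg _) (by norm_num)
      _ = 7 / 24 * (|x| * x ^ 2) := by rw [← sq_abs x]; ring
      _ ≤ 7 / 24 * (1 / 2 * x ^ 2) := by gcongr
      _ = 7 / 48 * x ^ 2 := by ring
  have hquartic : |x| ^ 4 ≤ 1 / 4 * x ^ 2 := by
    have hsq : |x| ^ 2 ≤ (1 / 2) ^ 2 := by gcongr
    rw [← sq_abs x]
    nlinarith [sq_nonneg |x|]
  obtain ⟨hl, hu⟩ := abs_le.mp hsin
  constructor <;> linarith [sq_nonneg x]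

theorem one_add_two_mul_cos_bounds {φ : ℝ} (hφ : |φ - 2 * π / 3| ≤ 1 / 2) :
    1 / 3 * (φ - 2 * π / 3) ^ 2 ≤ 1 + 2 * Real.cos φ + Real.sqrt 3 * (φ - 2 * π / 3) ∧
      1 + 2 * Real.cos φ + Real.sqrt 3 * (φ - 2 * π / 3) ≤ 2 / 3 * (φ - 2 * π / 3) ^ 2 := by
  have hcos : 2 * Real.cos φ =
      -Real.cos (φ - 2 * π / 3) - Real.sqrt 3 * Real.sin (φ - 2 * π / 3) := by
    conv_lhs => rw [show φ = π - (π / 3 - (φ - 2 * π / 3)) by ring]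
    rw [Real.cos_pi_sub, Real.cos_sub, Real.cos_pi_div_three, Real.sin_pi_div_three]
    ring
  rw [hcos]
  convert one_sub_cos_add_sqrt_three_mul_bounds hφ using 2 <;> ring

/-- Second-order Taylor-type two-sided bounds for `1 + 2cos φ` around its zeros `2π/3`
and `4π/3`. -/
theorem stmt_11 :
    (∀ φ : ℝ, |φ - 2 * π / 3| ≤ 1 / 2 →
      1 / 3 * (φ - 2 * π / 3) ^ 2 ≤ 1 + 2 * Real.cos φ + Real.sqrt 3 * (φ - 2 * π / 3) ∧
      1 + 2 * Real.cos φ + Real.sqrt 3 * (φ - 2 * π / 3) ≤ 2 / 3 * (φ - 2 * π / 3) ^ 2) ∧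
    (∀ φ : ℝ, |φ - 4 * π / 3| ≤ 1 / 2 →
      1 / 3 * (φ - 4 * π / 3) ^ 2 ≤ 1 + 2 * Real.cos φ - Real.sqrt 3 * (φ - 4 * π / 3) ∧
      1 + 2 * Real.cos φ - Real.sqrt 3 * (φ - 4 * π / 3) ≤ 2 / 3 * (φ - 4 * π / 3) ^ 2) := by
  refine ⟨fun φ hφ => one_add_two_mul_cos_bounds hφ, fun φ hφ => ?_⟩
  have hreflect : 2 * π - φ - 2 * π / 3 = -(φ - 4 * π / 3) := by ring
  have h := one_add_two_mul_cos_bounds (φ := 2 * π - φ) (by rwa [hreflect, abs_neg])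
  rwa [hreflect, Real.cos_two_pi_sub, neg_sq, mul_neg, ← sub_eq_add_neg] at h
end

section
/- Let ε > 0, let e be one of the three lattice directions ê₁ = (1, 0), ê₂ = (1/2, √3/2), ê₃ = (−1/2, √3/2), let ν ∈ ℝ² be a unit vector with |⟨e, ν^⊥⟩| ≤ 1/2 (where ν^⊥ = (−ν₂, ν₁)), and let L = {x ∈ ℝ² : ⟨x − x₀, ν⟩ = 0} be a line orthogonal to ν. For z ∈ ℤ let Σ^z_ε := {s·e + t·e^⊥ : s ∈ ℝ, t ∈ [ε(√3/2)z, ε(√3/2)(z+1)]}, where e^⊥ is e rotated counterclockwise by π/2. Then there exists a family (T_z)_{z∈ℤ} of upward ε-triangles such that for every z ∈ ℤ: T_z ⊆ Σ^z_ε, T_z ∩ L ≠ ∅, and T_z ∩ T_{z+1} ≠ ∅. -/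
open Real
open scoped Pointwise

/-- The lattice direction `ê₁ = (1,0)`. -/
noncomputable def e1 : ℝ × ℝ := (1, 0)

/-- The lattice direction `ê₂ = (1/2, √3/2)`. -/
noncomputable def e2 : ℝ × ℝ := (1 / 2, Real.sqrt 3 / 2)

/-- The lattice direction `ê₃ = (-1/2, √3/2)`. -/
noncomputable def e3 : ℝ × ℝ := (-(1 / 2), Real.sqrt 3 / 2)

/-- The triangular lattice `ℒ = {z₁ê₁ + z₂ê₂ : z₁, z₂ ∈ ℤ}`. -/
noncomputable def TriLat : Set (ℝ × ℝ) := {x | ∃ z₁ z₂ : ℤ, x = (z₁ : ℝ) • e1 + (z₂ : ℝ) • e2}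

/-- Counterclockwise rotation by `π/2`. -/
noncomputable def perp (v : ℝ × ℝ) : ℝ × ℝ := (-v.2, v.1)

/-- The Euclidean scalar product on `ℝ²`. -/
noncomputable def dot (a b : ℝ × ℝ) : ℝ := a.1 * b.1 + a.2 * b.2

/-- The point with coordinates `a`, `b` in the lattice basis `e1`, `e2`. -/
noncomputable def latPoint (a b : ℝ) : ℝ × ℝ := a • e1 + b • e2

/-- The upward `ε`-triangle based at the lattice point with integer coordinates `a`, `b`. -/
noncomputable def upTriangle (ε : ℝ) (a b : ℤ) : Set (ℝ × ℝ) :=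
  ε • convexHull ℝ {latPoint a b, latPoint a b + e1, latPoint a b + e2}

theorem latPoint_mem_triLat (a b : ℤ) : latPoint a b ∈ TriLat := ⟨a, b, rfl⟩

theorem convexHull_latPoint (a b : ℝ) :
    convexHull ℝ {latPoint a b, latPoint a b + e1, latPoint a b + e2} =
      {x | ∃ u v : ℝ, a ≤ u ∧ b ≤ v ∧ u + v ≤ a + b + 1 ∧ x = latPoint u v} := by
  apply Set.Subset.antisymm
  · refine convexHull_min ?_ ?_
    · rintro x (rfl | rfl | rfl)
      · exact ⟨a, b, le_rfl, le_rfl, by linarith, rfl⟩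
      · exact ⟨a + 1, b, by linarith, le_rfl, by linarith, by simp only [latPoint]; module⟩
      · exact ⟨a, b + 1, le_rfl, by linarith, by linarith, by simp only [latPoint]; module⟩
    · rintro _ ⟨u, v, hu, hv, huv, rfl⟩ _ ⟨u', v', hu', hv', huv', rfl⟩ α β hα hβ hαβ
      refine ⟨α * u + β * u', α * v + β * v', ?_, ?_, ?_, by simp only [latPoint]; module⟩
      all_goals
        obtain rfl : β = 1 - α := by linarith
        nlinarith
  · rintro _ ⟨u, v, hu, hv, huv, rfl⟩
    have hsub := subset_convexHull ℝ {latPoint a b, latPoint a b + e1, latPoint a b + e2}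
    have hmem := (convex_convexHull ℝ
      {latPoint a b, latPoint a b + e1, latPoint a b + e2}).sum_mem (t := Finset.univ)
      (w := ![a + b + 1 - u - v, u - a, v - b])
      (z := ![latPoint a b, latPoint a b + e1, latPoint a b + e2])
      (by intro i _; fin_cases i <;> simp <;> linarith)
      (by simp [Fin.sum_univ_three]; ring)
      (by intro i _; apply hsub; fin_cases i <;> simp)
    convert hmem using 1
    simp only [Fin.sum_univ_three, Matrix.cons_val, latPoint]
    module

theorem floor_bounds_of_step {x y : ℝ} (h : y ≤ x) (h' : x ≤ y + 1) :
    (⌊y⌋ : ℝ) ≤ ⌊x⌋ ∧ (⌊x⌋ : ℝ) ≤ ⌊y⌋ + 1 := by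
  refine ⟨mod_cast Int.floor_mono h, ?_⟩
  have := Int.floor_mono h'
  rw [Int.floor_add_one] at this
  exact_mod_cast this

theorem mem_upTriangle {ε : ℝ} {a b : ℤ} {x : ℝ × ℝ} :
    x ∈ upTriangle ε a b ↔
      ∃ u v : ℝ, (a : ℝ) ≤ u ∧ (b : ℝ) ≤ v ∧ u + v ≤ a + b + 1 ∧ x = ε • latPoint u v := by
  rw [upTriangle, convexHull_latPoint, Set.mem_smul_set]
  constructor
  · rintro ⟨_, ⟨u, v, hu, hv, huv, rfl⟩, rfl⟩
    exact ⟨u, v, hu, hv, huv, rfl⟩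
  · rintro ⟨u, v, hu, hv, huv, rfl⟩
    exact ⟨_, ⟨u, v, hu, hv, huv, rfl⟩, rfl⟩

/-- A line making an angle of at least `π/3` with the unit vector `e` crosses the equally spaced
lines parallel to `e` at points that advance by at most half a lattice step. -/
theorem exists_line_crossings {ε : ℝ} (hε : 0 < ε) {e ν : ℝ × ℝ} (he : e.1 ^ 2 + e.2 ^ 2 = 1)
    (hν : ν.1 ^ 2 + ν.2 ^ 2 = 1) (heν : |dot e (perp ν)| ≤ 1 / 2) (x₀ : ℝ × ℝ) :
    ∃ c ρ : ℝ, |ρ| ≤ 1 / 2 ∧ ∀ w : ℝ,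
      dot (ε • ((c + ρ * w) • e + (Real.sqrt 3 / 2 * w) • perp e) - x₀) ν = 0 := by
  have hsum : dot e ν ^ 2 + dot e (perp ν) ^ 2 = 1 := by
    simp only [dot, perp]
    linear_combination (ν.1 ^ 2 + ν.2 ^ 2) * he + hν
  have hperp : dot (perp e) ν = -dot e (perp ν) := by
    simp only [dot, perp]; ring
  have h3 : Real.sqrt 3 ^ 2 = 3 := Real.sq_sqrt (by norm_num)
  set d := dot e ν with hd
  set m := dot e (perp ν)
  have hm2 : m ^ 2 ≤ 1 / 4 := by
    nlinarith [sq_abs m, abs_nonneg m]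
  have hd0 : d ≠ 0 := by
    rintro h
    rw [h] at hsum
    linarith
  refine ⟨dot x₀ ν / (ε * d), Real.sqrt 3 / 2 * m / d, ?_, fun w ↦ ?_⟩
  · refine abs_le_of_sq_le_sq ?_ (by norm_num)
    rw [div_pow, div_le_iff₀ (by positivity), mul_pow, div_pow, h3]
    linarith
  · have expand : ∀ s t : ℝ, dot (ε • (s • e + t • perp e) - x₀) ν =
        ε * (s * d + t * dot (perp e) ν) - dot x₀ ν := by
      intro s t
      simp only [hd, dot, Prod.fst_sub, Prod.snd_sub, Prod.smul_fst, Prod.smul_snd, Prod.fst_add,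
        Prod.snd_add, smul_eq_mul]
      ring
    rw [expand, hperp]
    field_simp
    ring

/-- Existence of a chain of upward `ε`-triangles along a line `L` orthogonal to `ν`,
with one triangle in each lattice slice `Σ^z_ε` in a lattice direction `e` satisfying
`|⟨e, ν^⊥⟩| ≤ 1/2`, consecutive triangles intersecting, and all triangles meeting `L`. -/
theorem stmt_16 (ε : ℝ) (hε : 0 < ε) (e : ℝ × ℝ) (he : e = e1 ∨ e = e2 ∨ e = e3)
    (ν : ℝ × ℝ) (hν : ν.1 ^ 2 + ν.2 ^ 2 = 1) (heν : |dot e (perp ν)| ≤ 1 / 2)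
    (x₀ : ℝ × ℝ) :
    ∃ T : ℤ → Set (ℝ × ℝ), ∀ z : ℤ,
      (∃ p ∈ TriLat, T z = ε • convexHull ℝ {p, p + e1, p + e2}) ∧
      T z ⊆ {x | ∃ s t : ℝ,
        t ∈ Set.Icc (ε * (Real.sqrt 3 / 2) * (z : ℝ)) (ε * (Real.sqrt 3 / 2) * ((z : ℝ) + 1)) ∧
        x = s • e + t • perp e} ∧
      (T z ∩ {x | dot (x - x₀) ν = 0}).Nonempty ∧
      (T z ∩ T (z + 1)).Nonempty := by
  have h3 : Real.sqrt 3 ^ 2 = 3 := Real.sq_sqrt (by norm_num)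
  have hnorm : e.1 ^ 2 + e.2 ^ 2 = 1 := by
    rcases he with rfl | rfl | rfl <;> simp only [e1, e2, e3, neg_sq, div_pow, h3] <;> norm_num
  obtain ⟨c, ρ, hρ, hline⟩ := exists_line_crossings hε hnorm hν heν x₀
  obtain ⟨hρ₁, hρ₂⟩ := abs_le.mp hρ
  rcases he with rfl | rfl | rfl
  · have hcoord (s t : ℝ) : s • e1 + (Real.sqrt 3 / 2 * t) • perp e1 =
        latPoint (s - t / 2) t := by
      ext <;> simp [latPoint, e1, e2, perp] <;> ring
    let k (z : ℤ) : ℤ := ⌊c + ρ * z - z / 2⌋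
    refine ⟨fun z ↦ upTriangle ε (k z) z, fun z ↦
      ⟨⟨_, latPoint_mem_triLat _ _, rfl⟩, ?_, ?_, ?_⟩⟩
    · intro x hx
      obtain ⟨u, v, hu, hv, huv, rfl⟩ := mem_upTriangle.mp hx
      refine ⟨ε * (u + v / 2), ε * (Real.sqrt 3 / 2) * v, ⟨?_, ?_⟩, ?_⟩
      · gcongr
      · gcongr; linarith
      · rw [show latPoint u v = latPoint (u + v / 2 - v / 2) v by ring_nf, ← hcoord]
        module
    · refine ⟨_, mem_upTriangle.mpr ⟨c + ρ * z - z / 2, z, Int.floor_le _, le_rfl, ?_, rfl⟩, ?_⟩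
      · linarith [Int.lt_floor_add_one (c + ρ * z - z / 2)]
      · simpa only [hcoord, Set.mem_ofPred_eq] using hline z
    · obtain ⟨h₁, h₂⟩ : (k (z + 1) : ℝ) ≤ k z ∧ (k z : ℝ) ≤ k (z + 1) + 1 := by
        apply floor_bounds_of_step <;> push_cast <;> linarith
      refine ⟨ε • latPoint (k z) (z + 1), mem_upTriangle.mpr ⟨_, _, le_rfl, ?_, ?_, rfl⟩,
        mem_upTriangle.mpr ⟨_, _, ?_, ?_, ?_, rfl⟩⟩ <;> push_cast <;> linarith
  · have hcoord (s t : ℝ) : s • e2 + (Real.sqrt 3 / 2 * t) • perp e2 =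
        latPoint (-t) (s + t / 2) := by
      ext <;> simp [latPoint, e1, e2, perp]
      · linear_combination (-t / 4) * h3
      · ring
    let k (z : ℤ) : ℤ := ⌊c + ρ * (z + 1 : ℝ) + (z + 1) / 2⌋
    refine ⟨fun z ↦ upTriangle ε (-(z + 1)) (k z), fun z ↦
      ⟨⟨_, latPoint_mem_triLat _ _, rfl⟩, ?_, ?_, ?_⟩⟩
    · intro x hx
      obtain ⟨u, v, hu, hv, huv, rfl⟩ := mem_upTriangle.mp hx
      push_cast at hu huv
      refine ⟨ε * (v + u / 2), ε * (Real.sqrt 3 / 2) * -u, ⟨?_, ?_⟩, ?_⟩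
      · gcongr; linarith
      · gcongr; linarith
      · rw [show latPoint u v = latPoint (- -u) (v + u / 2 + -u / 2) by ring_nf, ← hcoord]
        module
    · refine ⟨_, mem_upTriangle.mpr ⟨-(z + 1), c + ρ * (z + 1) + (z + 1) / 2, ?_,
        Int.floor_le _, ?_, rfl⟩, ?_⟩
      · push_cast; rfl
      · push_cast
        linarith [Int.lt_floor_add_one (c + ρ * (z + 1 : ℝ) + (z + 1) / 2)]
      · simpa only [hcoord, Set.mem_ofPred_eq] using hline (z + 1)
    · obtain ⟨h₁, h₂⟩ : (k z : ℝ) ≤ k (z + 1) ∧ (k (z + 1) : ℝ) ≤ k z + 1 := by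
        apply floor_bounds_of_step <;> push_cast <;> linarith
      refine ⟨ε • latPoint (-(z + 1)) (k (z + 1)), mem_upTriangle.mpr ⟨_, _, ?_, ?_, ?_, rfl⟩,
        mem_upTriangle.mpr ⟨_, _, ?_, le_rfl, ?_, rfl⟩⟩ <;> push_cast <;> linarith
  · have hcoord (s t : ℝ) : s • e3 + (Real.sqrt 3 / 2 * t) • perp e3 =
        latPoint (-s - t / 2) (s - t / 2) := by
      ext <;> simp [latPoint, e1, e2, e3, perp]
      · linear_combination (-t / 4) * h3
      · ring
    let k (z : ℤ) : ℤ := ⌊-(c + ρ * z) - z / 2⌋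
    refine ⟨fun z ↦ upTriangle ε (k z) (-z - 1 - k z), fun z ↦
      ⟨⟨_, latPoint_mem_triLat _ _, rfl⟩, ?_, ?_, ?_⟩⟩
    · intro x hx
      obtain ⟨u, v, hu, hv, huv, rfl⟩ := mem_upTriangle.mp hx
      push_cast at hv huv
      refine ⟨ε * ((v - u) / 2), ε * (Real.sqrt 3 / 2) * (-u - v), ⟨?_, ?_⟩, ?_⟩
      · gcongr; linarith
      · gcongr; linarith
      · rw [show latPoint u v = latPoint (-((v - u) / 2) - (-u - v) / 2)
          ((v - u) / 2 - (-u - v) / 2) by ring_nf, ← hcoord]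
        module
    · have hlt := Int.lt_floor_add_one (-(c + ρ * z) - (z : ℝ) / 2)
      refine ⟨_, mem_upTriangle.mpr ⟨-(c + ρ * z) - z / 2, c + ρ * z - z / 2, Int.floor_le _,
        ?_, ?_, rfl⟩, ?_⟩
      · push_cast; linarith
      · push_cast; linarith
      · simpa only [hcoord, Set.mem_ofPred_eq] using hline z
    · obtain ⟨h₁, h₂⟩ : (k (z + 1) : ℝ) ≤ k z ∧ (k z : ℝ) ≤ k (z + 1) + 1 := by
        apply floor_bounds_of_step <;> push_cast <;> linarith
      refine ⟨ε • latPoint (k z) (-z - 1 - k z), mem_upTriangle.mpr ⟨_, _, le_rfl, ?_, ?_, rfl⟩,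
        mem_upTriangle.mpr ⟨_, _, ?_, ?_, ?_, rfl⟩⟩ <;> push_cast <;> linarith
end
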